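/- Let p, q ≥ 1 with θ := 1/p + 1/q > 1, let x : [a,b] → ℝ^{d×m} be continuous of finite q-variation and ω : [a,b] → ℝ^m continuous of finite p-variation. Then the indefinite Young integral t ↦ ∫_a^t x_u dω_u has finite p-variation and |||∫_a^· x_u dω_u|||_{p-var,[a,b]} ≤ |||ω|||_{p-var,[a,b]} · ( |x_a| + (K+1) |||x|||_{q-var,[a,b]} ), where K := (1 − 2^{1−θ})^{−1}. -/

import Mathlib

open scoped BigOperators
open Set

noncomputable section

/-- Euclidean space `ℝ^n`. -/
abbrev Ed (n : ℕ) : Type := EuclideanSpace ℝ (Fin n)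

section PVarDefs

variable {E F : Type*} [NormedAddCommGroup E] [NormedSpace ℝ E]
  [NormedAddCommGroup F] [NormedSpace ℝ F]

/-- The set of sums `Σ_i ‖x (t (i+1)) - x (t i)‖ ^ p` over all finite partitions
`a = t 0 < t 1 < ⋯ < t n = b` of `[a,b]`. -/
def pVarSums (p : ℝ) (x : ℝ → E) (a b : ℝ) : Set ℝ :=
  { v | ∃ n : ℕ, ∃ t : Fin (n + 1) → ℝ, StrictMono t ∧ t 0 = a ∧ t (Fin.last n) = b ∧
      v = ∑ i : Fin n, ‖x (t i.succ) - x (t i.castSucc)‖ ^ p }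

/-- The `p`-variation seminorm `|||x|||_{p-var,[a,b]}`. -/
def pVar (p : ℝ) (x : ℝ → E) (a b : ℝ) : ℝ :=
  sSup (pVarSums p x a b) ^ (1 / p)

/-- `x` is of finite `p`-variation on `[a,b]`. -/
def FinitePVar (p : ℝ) (x : ℝ → E) (a b : ℝ) : Prop :=
  BddAbove (pVarSums p x a b)

/-- The `p`-variation norm `‖x‖_{p-var,[a,b]} = ‖x a‖ + |||x|||_{p-var,[a,b]}`. -/
def pVarNorm (p : ℝ) (x : ℝ → E) (a b : ℝ) : ℝ :=
  ‖x a‖ + pVar p x a b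

/-- A control function on `[a,b]`: continuous on the simplex, vanishing on the diagonal,
superadditive and nonnegative. -/
def IsControlOn (a b : ℝ) (w : ℝ → ℝ → ℝ) : Prop :=
  ContinuousOn (fun pr : ℝ × ℝ => w pr.1 pr.2) {pr : ℝ × ℝ | a ≤ pr.1 ∧ pr.1 ≤ pr.2 ∧ pr.2 ≤ b} ∧
  (∀ t : ℝ, a ≤ t → t ≤ b → w t t = 0) ∧
  (∀ s t u : ℝ, a ≤ s → s ≤ t → t ≤ u → u ≤ b → w s t + w t u ≤ w s u) ∧
  (∀ s t : ℝ, a ≤ s → s ≤ t → t ≤ b → 0 ≤ w s t)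

/-- A tagged partition `a = t 0 < t 1 < ⋯ < t n = b` of `[a,b]`, with tags
`tag i ∈ [t i, t (i+1)]`. -/
structure TaggedPartition (a b : ℝ) where
  n : ℕ
  t : Fin (n + 1) → ℝ
  tag : Fin n → ℝ
  mono : StrictMono t
  first : t 0 = a
  last : t (Fin.last n) = b
  tag_mem : ∀ i : Fin n, tag i ∈ Set.Icc (t i.castSucc) (t i.succ)

/-- The mesh of a tagged partition. -/
def TaggedPartition.mesh {a b : ℝ} (P : TaggedPartition a b) : ℝ :=
  ⨆ i : Fin P.n, (P.t i.succ - P.t i.castSucc)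

/-- Riemann–Stieltjes sum of `x` against `ω` along a tagged partition. -/
def RSSum (x : ℝ → E →L[ℝ] F) (ω : ℝ → E) {a b : ℝ} (P : TaggedPartition a b) : F :=
  ∑ i : Fin P.n, x (P.tag i) (ω (P.t i.succ) - ω (P.t i.castSucc))

/-- `v` is the Young integral `∫_a^b x dω`: the Riemann–Stieltjes sums converge to `v`
as the mesh tends to `0`. -/
def IsYoungIntegral (x : ℝ → E →L[ℝ] F) (ω : ℝ → E) (a b : ℝ) (v : F) : Prop :=
  ∀ ε : ℝ, 0 < ε → ∃ δ : ℝ, 0 < δ ∧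
    ∀ P : TaggedPartition a b, P.mesh < δ → ‖RSSum x ω P - v‖ < ε

/-- The Young integral `∫_a^b x dω` (an arbitrary value, `0`, if the limit does not exist). -/
def youngIntegral (x : ℝ → E →L[ℝ] F) (ω : ℝ → E) (a b : ℝ) : F :=
  letI := Classical.propDecidable (∃ v, IsYoungIntegral x ω a b v)
  if hv : ∃ v, IsYoungIntegral x ω a b v then hv.choose else 0

end PVarDefs

/-! ### Subdivisions indexed by natural numbers -/

/-- `a = T 0 < T 1 < ⋯ < T n = b`; the values of `T` beyond `n` are irrelevant. -/
structure IsSubdivision (n : ℕ) (T : ℕ → ℝ) (a b : ℝ) : Prop where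
  lt_succ : ∀ i < n, T i < T (i + 1)
  first : T 0 = a
  last : T n = b

namespace IsSubdivision

variable {n : ℕ} {T : ℕ → ℝ} {a b : ℝ}

theorem strictMonoOn (h : IsSubdivision n T a b) : StrictMonoOn T (Set.Iic n) := by
  intro i _ j hj hij
  induction j, hij using Nat.le_induction with
  | base => exact h.lt_succ i hj
  | succ k hik ih =>
    have hk : k < n := hj
    exact (ih hk.le).trans (h.lt_succ k hk)

theorem monotoneOn (h : IsSubdivision n T a b) : MonotoneOn T (Set.Iic n) :=
  h.strictMonoOn.monotoneOn

theorem left_le (h : IsSubdivision n T a b) {i : ℕ} (hi : i ≤ n) : a ≤ T i :=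
  h.first ▸ h.monotoneOn (Set.mem_Iic.2 n.zero_le) hi i.zero_le

theorem le_right (h : IsSubdivision n T a b) {i : ℕ} (hi : i ≤ n) : T i ≤ b :=
  h.last ▸ h.monotoneOn hi (Set.mem_Iic.2 le_rfl) hi

theorem concat {n' : ℕ} {T' : ℕ → ℝ} {c : ℝ} (h : IsSubdivision n T a b)
    (h' : IsSubdivision n' T' b c) :
    IsSubdivision (n + n') (fun i => if i ≤ n then T i else T' (i - n)) a c where
  lt_succ i hi := by
    rcases lt_trichotomy i n with hin | rfl | hin
    · simpa [hin.le, Nat.succ_le_of_lt hin] using h.lt_succ i hin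
    · simpa [h.last, h'.first] using h'.lt_succ 0 (by omega)
    · have := h'.lt_succ (i - n) (by omega)
      rw [← Nat.sub_add_comm hin.le] at this
      simpa [not_le.2 hin, show ¬ i + 1 ≤ n by omega] using this
  first := by simpa using h.first
  last := by
    rcases Nat.eq_zero_or_pos n' with rfl | hn'
    · simp [h.last, ← h'.first, h'.last]
    · simpa [show ¬ n' = 0 by omega] using h'.last

theorem refl (a : ℝ) : IsSubdivision 0 (fun _ => a) a a := ⟨by simp, rfl, rfl⟩

theorem exists_fine {s t δ : ℝ} (hst : s ≤ t) (hδ : 0 < δ) :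
    ∃ n T, IsSubdivision n T s t ∧ ∀ i < n, T (i + 1) - T i ≤ δ := by
  rcases hst.eq_or_lt with rfl | hst
  · exact ⟨0, _, refl s, by simp⟩
  obtain ⟨n, hn⟩ := exists_nat_ge ((t - s) / δ)
  have hn0 : (0 : ℝ) < n := (div_pos (sub_pos.2 hst) hδ).trans_le hn
  have step : ∀ i : ℕ, s + (t - s) * ((i + 1 : ℕ) / n) - (s + (t - s) * (i / n)) = (t - s) / n := by
    intro i; push_cast; field_simp; ring
  refine ⟨n, fun i => s + (t - s) * (i / n), ⟨fun i _ => ?_, by simp, ?_⟩, fun i _ => ?_⟩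
  · exact sub_pos.1 (step i ▸ div_pos (sub_pos.2 hst) hn0)
  · field_simp; ring
  · rw [step i, div_le_iff₀ hn0, mul_comm]
    exact (div_le_iff₀ hδ).1 hn

theorem exists_of_finset (U : Finset ℝ) (hU : U.Nonempty) :
    ∃ N T, IsSubdivision N T (T 0) (T N) ∧ ∀ u ∈ U, ∃ k ≤ N, T k = u := by
  obtain ⟨N, hN⟩ : ∃ N, U.card = N + 1 := ⟨U.card - 1, by have := hU.card_pos; omega⟩
  refine ⟨N, fun k => U.orderEmbOfFin hN ⟨min k N, by omega⟩, ⟨fun i hi => ?_, rfl, rfl⟩, ?_⟩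
  · refine (U.orderEmbOfFin hN).strictMono ?_
    simp only [Fin.mk_lt_mk]; omega
  · intro u hu
    have : u ∈ Set.range (U.orderEmbOfFin hN) := by simpa using hu
    obtain ⟨k, rfl⟩ := this
    exact ⟨k, by omega, congrArg _ (Fin.ext (Nat.min_eq_left (by omega)))⟩

end IsSubdivision

/-! ### Superadditive functions of an interval -/

/-- Hölder's inequality for two summands, with exponents of sum at least `1`. -/
theorem rpow_mul_rpow_add_le {α β a₁ a₂ b₁ b₂ : ℝ} (hα : 0 < α) (hβ : 0 < β)
    (hαβ : 1 ≤ α + β) (ha₁ : 0 ≤ a₁) (ha₂ : 0 ≤ a₂) (hb₁ : 0 ≤ b₁) (hb₂ : 0 ≤ b₂) :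
    a₁ ^ α * b₁ ^ β + a₂ ^ α * b₂ ^ β ≤ (a₁ + a₂) ^ α * (b₁ + b₂) ^ β := by
  set A := a₁ + a₂
  set B := b₁ + b₂
  have hθ : 0 < α + β := by linarith
  rcases (show 0 ≤ A by positivity).eq_or_lt with hA | hA
  · have h1 : a₁ = 0 := by linarith
    have h2 : a₂ = 0 := by linarith
    simp [h1, h2, ← hA, Real.zero_rpow hα.ne']
  rcases (show 0 ≤ B by positivity).eq_or_lt with hB | hB
  · have h1 : b₁ = 0 := by linarith
    have h2 : b₂ = 0 := by linarith
    simp [h1, h2, ← hB, Real.zero_rpow hβ.ne']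
  have young : ∀ u v : ℝ, 0 ≤ u → 0 ≤ v → u ≤ A → v ≤ B →
      u ^ α * v ^ β ≤ A ^ α * B ^ β * (α / (α + β) * (u / A) + β / (α + β) * (v / B)) := by
    intro u v hu hv huA hvB
    have hu' : 0 ≤ u / A := by positivity
    have hv' : 0 ≤ v / B := by positivity
    have e1 : u ^ α * v ^ β = A ^ α * B ^ β * ((u / A) ^ α * (v / B) ^ β) := by
      rw [Real.div_rpow hu hA.le, Real.div_rpow hv hB.le]
      have := (Real.rpow_pos_of_pos hA α).ne'
      have := (Real.rpow_pos_of_pos hB β).ne'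
      field_simp
    rw [e1]
    refine mul_le_mul_of_nonneg_left ?_ (by positivity)
    refine le_trans ?_ (Real.geom_mean_le_arith_mean2_weighted (by positivity) (by positivity)
      hu' hv' (by field_simp))
    refine mul_le_mul ?_ ?_ (by positivity) (by positivity)
    · exact Real.rpow_le_rpow_of_exponent_ge' hu' ((div_le_one hA).2 huA) (by positivity)
        (div_le_self hα.le hαβ)
    · exact Real.rpow_le_rpow_of_exponent_ge' hv' ((div_le_one hB).2 hvB) (by positivity)
        (div_le_self hβ.le hαβ)
  have h1 := young a₁ b₁ ha₁ hb₁ (by simp [A, ha₂]) (by simp [B, hb₂])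
  have h2 := young a₂ b₂ ha₂ hb₂ (by simp [A, ha₁]) (by simp [B, hb₁])
  have h3 : A ^ α * B ^ β * (α / (α + β) * (a₁ / A) + β / (α + β) * (b₁ / B)) +
      A ^ α * B ^ β * (α / (α + β) * (a₂ / A) + β / (α + β) * (b₂ / B)) = A ^ α * B ^ β := by
    have e1 : a₁ / A + a₂ / A = 1 := by rw [← add_div]; exact div_self hA.ne'
    have e2 : b₁ / B + b₂ / B = 1 := by rw [← add_div]; exact div_self hB.ne'
    have e3 : α / (α + β) + β / (α + β) = 1 := by rw [← add_div]; exact div_self hθ.ne'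
    linear_combination (A ^ α * B ^ β) * (α / (α + β) * e1 + β / (α + β) * e2 + e3)
  linarith

/-- `W s t` is nonnegative and superadditive for `a ≤ s ≤ t ≤ b`. -/
structure SuperadditiveOn (W : ℝ → ℝ → ℝ) (a b : ℝ) : Prop where
  nonneg : ∀ s t, a ≤ s → s ≤ t → t ≤ b → 0 ≤ W s t
  add_le : ∀ s u t, a ≤ s → s ≤ u → u ≤ t → t ≤ b → W s u + W u t ≤ W s t

namespace SuperadditiveOn

variable {W : ℝ → ℝ → ℝ} {a b : ℝ}

theorem restrict (h : SuperadditiveOn W a b) {s t : ℝ} (hs : a ≤ s) (ht : t ≤ b) :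
    SuperadditiveOn W s t where
  nonneg u v hu huv hv := h.nonneg u v (hs.trans hu) huv (hv.trans ht)
  add_le u v w hu huv hvw hw := h.add_le u v w (hs.trans hu) huv hvw (hw.trans ht)

theorem mono (h : SuperadditiveOn W a b) {s u v t : ℝ} (hs : a ≤ s) (hsu : s ≤ u) (huv : u ≤ v)
    (hvt : v ≤ t) (ht : t ≤ b) : W u v ≤ W s t := by
  have h1 := h.add_le s u v hs hsu huv (hvt.trans ht)
  have h2 := h.add_le s v t hs (hsu.trans huv) hvt ht
  have h3 := h.nonneg s u hs hsu (huv.trans (hvt.trans ht))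
  have h4 := h.nonneg v t (hs.trans (hsu.trans huv)) hvt ht
  linarith

theorem self_eq_zero (h : SuperadditiveOn W a b) {s : ℝ} (hs : a ≤ s) (hs' : s ≤ b) :
    W s s = 0 := by
  have h1 := h.add_le s s s hs le_rfl le_rfl hs'
  have h2 := h.nonneg s s hs le_rfl hs'
  linarith

theorem sum_le (h : SuperadditiveOn W a b) {n : ℕ} {T : ℕ → ℝ} (hT : IsSubdivision n T a b) :
    ∑ i ∈ Finset.range n, W (T i) (T (i + 1)) ≤ W a b := by
  have key : ∀ k ≤ n, ∑ i ∈ Finset.range k, W (T i) (T (i + 1)) ≤ W a (T k) := by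
    intro k
    induction k with
    | zero => intro _; simpa using h.nonneg a (T 0) le_rfl hT.first.ge (hT.le_right n.zero_le)
    | succ k ih =>
      intro hk
      rw [Finset.sum_range_succ]
      have := h.add_le a (T k) (T (k + 1)) le_rfl (hT.left_le (by omega)) (hT.lt_succ k hk).le
        (hT.le_right hk)
      linarith [ih (by omega)]
  simpa [hT.last] using key n le_rfl

theorem rpow_mul_rpow {V : ℝ → ℝ → ℝ} (hV : SuperadditiveOn V a b) (hW : SuperadditiveOn W a b)
    {α β : ℝ} (hα : 0 < α) (hβ : 0 < β) (hαβ : 1 ≤ α + β) :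
    SuperadditiveOn (fun s t => V s t ^ α * W s t ^ β) a b where
  nonneg s t hs hst ht :=
    mul_nonneg (Real.rpow_nonneg (hV.nonneg s t hs hst ht) _)
      (Real.rpow_nonneg (hW.nonneg s t hs hst ht) _)
  add_le s u t hs hsu hut ht := by
    have hV1 := hV.nonneg s u hs hsu (hut.trans ht)
    have hV2 := hV.nonneg u t (hs.trans hsu) hut ht
    have hW1 := hW.nonneg s u hs hsu (hut.trans ht)
    have hW2 := hW.nonneg u t (hs.trans hsu) hut ht
    refine (rpow_mul_rpow_add_le hα hβ hαβ hV1 hV2 hW1 hW2).trans ?_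
    exact mul_le_mul
      (Real.rpow_le_rpow (by positivity) (hV.add_le s u t hs hsu hut ht) hα.le)
      (Real.rpow_le_rpow (by positivity) (hW.add_le s u t hs hsu hut ht) hβ.le)
      (by positivity) (Real.rpow_nonneg (hV.nonneg s t hs (hsu.trans hut) ht) _)

/-- A subdivided interval splits, up to one step, into two parts on which `W` is at most half. -/
theorem exists_halving (h : SuperadditiveOn W a b) {n i k : ℕ} {T : ℕ → ℝ}
    (hT : MonotoneOn T (Set.Iic n)) (hik : i < k) (hk : k ≤ n) (hi : a ≤ T i) (hkb : T k ≤ b) :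
    ∃ j, i ≤ j ∧ j < k ∧ W (T i) (T j) ≤ W (T i) (T k) / 2 ∧
      W (T (j + 1)) (T k) ≤ W (T i) (T k) / 2 := by
  by_contra! hcon
  have mono : ∀ {u v}, u ≤ v → v ≤ k → T u ≤ T v := fun {u v} huv hv =>
    hT (Set.mem_Iic.2 (huv.trans (hv.trans hk))) (Set.mem_Iic.2 (hv.trans hk)) huv
  have h0 := h.nonneg (T i) (T k) hi (mono hik.le le_rfl) hkb
  have key : ∀ j, i ≤ j → j ≤ k → W (T i) (T j) ≤ W (T i) (T k) / 2 := by
    intro j hij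
    induction j, hij using Nat.le_induction with
    | base =>
      intro _
      rw [h.self_eq_zero hi ((mono hik.le le_rfl).trans hkb)]
      positivity
    | succ j hij ih =>
      intro hj
      have h1 := hcon j hij hj (ih (by omega))
      have h2 := h.add_le (T i) (T (j + 1)) (T k) hi (mono (by omega) hj) (mono hj le_rfl) hkb
      linarith
  have h1 := hcon (k - 1) (by omega) (by omega) (key _ (by omega) (by omega))
  rw [Nat.sub_add_cancel (by omega),
    h.self_eq_zero (hi.trans (mono hik.le le_rfl)) hkb] at h1
  linarith

end SuperadditiveOn

/-! ### The Young–Loève estimate for left-point sums -/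

theorem two_mul_half_rpow {r : ℝ} (hr : 0 ≤ r) (θ : ℝ) :
    2 * (r / 2) ^ θ = 2 ^ (1 - θ) * r ^ θ := by
  rw [Real.div_rpow hr zero_le_two, Real.rpow_sub zero_lt_two, Real.rpow_one]
  ring

theorem two_rpow_one_sub_lt_one {θ : ℝ} (hθ : 1 < θ) : (2 : ℝ) ^ (1 - θ) < 1 :=
  Real.rpow_lt_one_of_one_lt_of_neg one_lt_two (by linarith)

/-- The Young–Loève constant. -/
def youngConst (θ : ℝ) : ℝ := (1 - (2 : ℝ) ^ (1 - θ))⁻¹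

theorem youngConst_pos {θ : ℝ} (hθ : 1 < θ) : 0 < youngConst θ :=
  inv_pos.2 (sub_pos.2 (two_rpow_one_sub_lt_one hθ))

theorem youngConst_eq {θ : ℝ} (hθ : 1 < θ) :
    (2 : ℝ) ^ (1 - θ) * youngConst θ + 1 = youngConst θ := by
  have : 1 - (2 : ℝ) ^ (1 - θ) ≠ 0 := (sub_pos.2 (two_rpow_one_sub_lt_one hθ)).ne'
  rw [youngConst]
  field_simp
  ring

section YoungIntegral

variable {E F : Type*} [NormedAddCommGroup E] [NormedSpace ℝ E]
  [NormedAddCommGroup F] [NormedSpace ℝ F]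

/-- The left-point Riemann–Stieltjes sum along `T i, …, T k`. -/
def leftSum (x : ℝ → E →L[ℝ] F) (ω : ℝ → E) (T : ℕ → ℝ) (i k : ℕ) : F :=
  ∑ l ∈ Finset.Ico i k, x (T l) (ω (T (l + 1)) - ω (T l))

/-- The difference between the left-point sum and its one-step approximation. -/
def leftDefect (x : ℝ → E →L[ℝ] F) (ω : ℝ → E) (T : ℕ → ℝ) (i k : ℕ) : F :=
  leftSum x ω T i k - x (T i) (ω (T k) - ω (T i))

variable {x : ℝ → E →L[ℝ] F} {ω : ℝ → E} {T : ℕ → ℝ}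

theorem leftSum_add {i j k : ℕ} (hij : i ≤ j) (hjk : j ≤ k) :
    leftSum x ω T i j + leftSum x ω T j k = leftSum x ω T i k :=
  Finset.sum_Ico_consecutive _ hij hjk

theorem leftDefect_self (i : ℕ) : leftDefect x ω T i i = 0 := by
  simp [leftDefect, leftSum]

theorem leftDefect_succ (i : ℕ) : leftDefect x ω T i (i + 1) = 0 := by
  simp [leftDefect, leftSum]

theorem leftDefect_split {i j k : ℕ} (hij : i ≤ j) (hjk : j ≤ k) :
    leftDefect x ω T i k = leftDefect x ω T i j + leftDefect x ω T j k +
      (x (T j) - x (T i)) (ω (T k) - ω (T j)) := by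
  simp only [leftDefect, ← leftSum_add hij hjk, sub_apply, map_sub]
  abel

theorem norm_leftDefect_split_le {i j k : ℕ} (hij : i ≤ j) (hjk : j < k) :
    ‖leftDefect x ω T i k‖ ≤ ‖leftDefect x ω T i j‖ + ‖leftDefect x ω T (j + 1) k‖ +
      ‖x (T j) - x (T i)‖ * ‖ω (T k) - ω (T j)‖ +
      ‖x (T (j + 1)) - x (T j)‖ * ‖ω (T k) - ω (T (j + 1))‖ := by
  rw [leftDefect_split hij hjk.le, leftDefect_split (Nat.le_succ j) hjk, leftDefect_succ, zero_add]
  have h1 := (x (T j) - x (T i)).le_opNorm (ω (T k) - ω (T j))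
  have h2 := (x (T (j + 1)) - x (T j)).le_opNorm (ω (T k) - ω (T (j + 1)))
  refine (norm_add_le _ _).trans ?_
  refine (add_le_add_left (norm_add_le _ _) _).trans ?_
  have h3 := norm_add_le (leftDefect x ω T (j + 1) k)
    ((x (T (j + 1)) - x (T j)) (ω (T k) - ω (T (j + 1))))
  simp only [Nat.succ_eq_add_one] at *
  linarith

variable {W : ℝ → ℝ → ℝ} {s t θ c η : ℝ} {n : ℕ}

theorem norm_leftDefect_le (hW : SuperadditiveOn W s t) (hθ : 1 < θ) (hc : 0 ≤ c)
    (hxω : ∀ u v w, s ≤ u → u ≤ v → v ≤ w → w ≤ t →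
      ‖x v - x u‖ * ‖ω w - ω v‖ ≤ c * W u w ^ θ)
    (hT : MonotoneOn T (Set.Iic n)) {i k : ℕ} (hik : i ≤ k) (hk : k ≤ n)
    (hi : s ≤ T i) (hkt : T k ≤ t) :
    ‖leftDefect x ω T i k‖ ≤ 2 * c * youngConst θ * W (T i) (T k) ^ θ := by
  induction hd : k - i using Nat.strong_induction_on generalizing i k with
  | _ d ih =>
  have mono : ∀ {u v}, u ≤ v → v ≤ k → T u ≤ T v := fun {u v} huv hv =>
    hT (Set.mem_Iic.2 (huv.trans (hv.trans hk))) (Set.mem_Iic.2 (hv.trans hk)) huv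
  have hr := hW.nonneg (T i) (T k) hi (mono hik le_rfl) hkt
  have hK := (youngConst_pos hθ).le
  rcases hik.eq_or_lt with rfl | hlt
  · rw [leftDefect_self, norm_zero]
    positivity
  obtain ⟨j, hij, hjk, h1, h2⟩ := hW.exists_halving hT hlt hk hi hkt
  have hsj : s ≤ T j := hi.trans (mono hij hjk.le)
  have hjt : T j ≤ t := (mono hjk.le le_rfl).trans hkt
  have hsj' : s ≤ T (j + 1) := hsj.trans (mono j.le_succ hjk)
  have e1 := ih (j - i) (by omega) hij (hjk.le.trans hk) hi hjt rfl
  have e2 := ih (k - (j + 1)) (by omega) hjk hk hsj' hkt rfl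
  have e3 := hxω _ _ _ hi (mono hij hjk.le) (mono hjk.le le_rfl) hkt
  have e4 := (hxω _ _ _ hsj (mono j.le_succ hjk) (mono hjk le_rfl) hkt).trans
    (mul_le_mul_of_nonneg_left (Real.rpow_le_rpow
      (hW.nonneg _ _ hsj (mono hjk.le le_rfl) hkt)
      (hW.mono hi (mono hij hjk.le) (mono hjk.le le_rfl) le_rfl hkt) (by linarith)) hc)
  have p1 := mul_le_mul_of_nonneg_left (Real.rpow_le_rpow
    (hW.nonneg _ _ hi (mono hij hjk.le) hjt) h1 (by linarith : 0 ≤ θ))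
    (by positivity : 0 ≤ 2 * c * youngConst θ)
  have p2 := mul_le_mul_of_nonneg_left (Real.rpow_le_rpow
    (hW.nonneg _ _ hsj' (mono hjk le_rfl) hkt) h2 (by linarith : 0 ≤ θ))
    (by positivity : 0 ≤ 2 * c * youngConst θ)
  refine (norm_leftDefect_split_le hij hjk).trans ?_
  have e5 := two_mul_half_rpow hr θ
  have e6 := youngConst_eq hθ
  have e7 : 2 * (2 * c * youngConst θ * (W (T i) (T k) / 2) ^ θ) + 2 * (c * W (T i) (T k) ^ θ) =
      2 * c * youngConst θ * W (T i) (T k) ^ θ := by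
    linear_combination 2 * c * youngConst θ * e5 + 2 * c * W (T i) (T k) ^ θ * e6
  linarith

/-- Up to an error controlled by single steps, the defect satisfies the estimate with a constant
arbitrarily close to `youngConst θ`. -/
theorem norm_leftDefect_le_of_step (hW : SuperadditiveOn W s t) (hθ : 1 < θ)
    (hxω : ∀ u v w, s ≤ u → u ≤ v → v ≤ w → w ≤ t → ‖x v - x u‖ * ‖ω w - ω v‖ ≤ W u w ^ θ)
    (hT : MonotoneOn T (Set.Iic n)) (hη : 0 ≤ η)
    (hstep : ∀ j k, j < k → k ≤ n → ‖x (T (j + 1)) - x (T j)‖ * ‖ω (T k) - ω (T (j + 1))‖ ≤ η)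
    (N : ℕ) {i k : ℕ} (hik : i ≤ k) (hk : k ≤ n) (hi : s ≤ T i) (hkt : T k ≤ t) :
    ‖leftDefect x ω T i k‖ ≤
      youngConst θ * (1 + ((2 : ℝ) ^ (1 - θ)) ^ N) * W (T i) (T k) ^ θ + (2 ^ N - 1) * η := by
  induction N generalizing i k with
  | zero =>
    have := norm_leftDefect_le hW hθ zero_le_one (by simpa using hxω) hT hik hk hi hkt
    simp only [pow_zero, sub_self, zero_mul, add_zero]
    linarith
  | succ N ih =>
    have mono : ∀ {u v}, u ≤ v → v ≤ k → T u ≤ T v := fun {u v} huv hv =>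
      hT (Set.mem_Iic.2 (huv.trans (hv.trans hk))) (Set.mem_Iic.2 (hv.trans hk)) huv
    have hr := hW.nonneg (T i) (T k) hi (mono hik le_rfl) hkt
    have hK := (youngConst_pos hθ).le
    rcases hik.eq_or_lt with rfl | hlt
    · rw [leftDefect_self, norm_zero]
      have : (1 : ℝ) ≤ 2 ^ (N + 1) := one_le_pow₀ one_le_two
      have := mul_nonneg (sub_nonneg.2 this) hη
      positivity
    obtain ⟨j, hij, hjk, h1, h2⟩ := hW.exists_halving hT hlt hk hi hkt
    have hjt : T j ≤ t := (mono hjk.le le_rfl).trans hkt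
    have hsj' : s ≤ T (j + 1) := hi.trans (mono (hij.trans j.le_succ) hjk)
    have e1 := ih hij (hjk.le.trans hk) hi hjt
    have e2 := ih hjk hk hsj' hkt
    have e3 := hxω _ _ _ hi (mono hij hjk.le) (mono hjk.le le_rfl) hkt
    have e4 := hstep j k hjk hk
    have hC : 0 ≤ youngConst θ * (1 + ((2 : ℝ) ^ (1 - θ)) ^ N) := by positivity
    have p1 := mul_le_mul_of_nonneg_left (Real.rpow_le_rpow
      (hW.nonneg _ _ hi (mono hij hjk.le) hjt) h1 (by linarith : 0 ≤ θ)) hC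
    have p2 := mul_le_mul_of_nonneg_left (Real.rpow_le_rpow
      (hW.nonneg _ _ hsj' (mono hjk le_rfl) hkt) h2 (by linarith : 0 ≤ θ)) hC
    refine (norm_leftDefect_split_le hij hjk).trans ?_
    have e5 := two_mul_half_rpow hr θ
    have e6 := youngConst_eq hθ
    have e7 : 2 * (youngConst θ * (1 + ((2 : ℝ) ^ (1 - θ)) ^ N) * (W (T i) (T k) / 2) ^ θ) +
        W (T i) (T k) ^ θ =
        youngConst θ * (1 + ((2 : ℝ) ^ (1 - θ)) ^ (N + 1)) * W (T i) (T k) ^ θ := by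
      linear_combination youngConst θ * (1 + ((2 : ℝ) ^ (1 - θ)) ^ N) * e5 +
        W (T i) (T k) ^ θ * e6
    have e8 : 2 * (((2 : ℝ) ^ N - 1) * η) + η = (2 ^ (N + 1) - 1) * η := by ring
    linarith

/-! ### Tagged partitions as subdivisions -/

theorem TaggedPartition.exists_isSubdivision {a b : ℝ} (P : TaggedPartition a b) :
    ∃ T ξ : ℕ → ℝ, IsSubdivision P.n T a b ∧
      (∀ i < P.n, ξ i ∈ Set.Icc (T i) (T (i + 1))) ∧
      (∀ i < P.n, T (i + 1) - T i ≤ P.mesh) ∧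
      ∀ (x : ℝ → E →L[ℝ] F) (ω : ℝ → E),
        RSSum x ω P = ∑ i ∈ Finset.range P.n, x (ξ i) (ω (T (i + 1)) - ω (T i)) := by
  set T : ℕ → ℝ := fun k => P.t ⟨min k P.n, by omega⟩
  have hT0 : ∀ i : Fin P.n, T i = P.t i.castSucc := fun i =>
    congrArg P.t (Fin.ext (Nat.min_eq_left i.2.le))
  have hT1 : ∀ i : Fin P.n, T (i + 1) = P.t i.succ := fun i =>
    congrArg P.t (Fin.ext (Nat.min_eq_left i.2))
  set ξ : ℕ → ℝ := fun k => if h : k < P.n then P.tag ⟨k, h⟩ else 0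
  have hξ : ∀ i : Fin P.n, ξ i = P.tag i := fun i => by simp [ξ]
  refine ⟨T, ξ, ⟨fun i hi => ?_, ?_, ?_⟩, fun i hi => ?_, fun i hi => ?_, fun x ω => ?_⟩
  · rw [hT0 ⟨i, hi⟩, hT1 ⟨i, hi⟩]
    exact P.mono Fin.castSucc_lt_succ
  · exact (congrArg P.t (Fin.ext (by simp))).trans P.first
  · exact (congrArg P.t (Fin.ext (by simp))).trans P.last
  · rw [hT0 ⟨i, hi⟩, hT1 ⟨i, hi⟩, hξ ⟨i, hi⟩]
    exact P.tag_mem _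
  · rw [hT0 ⟨i, hi⟩, hT1 ⟨i, hi⟩]
    exact le_ciSup (f := fun i : Fin P.n => P.t i.succ - P.t i.castSucc)
      (Set.finite_range _).bddAbove ⟨i, hi⟩
  · rw [RSSum, Finset.sum_range]
    exact Finset.sum_congr rfl fun i _ => by rw [hT0, hT1, hξ]

theorem IsSubdivision.exists_taggedPartition {a b δ : ℝ} (hT : IsSubdivision n T a b) (hδ : 0 ≤ δ)
    (hstep : ∀ i < n, T (i + 1) - T i ≤ δ) :
    ∃ P : TaggedPartition a b, P.mesh ≤ δ ∧
      ∀ (x : ℝ → E →L[ℝ] F) (ω : ℝ → E), RSSum x ω P = leftSum x ω T 0 n := by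
  refine ⟨⟨n, fun i => T i, fun i => T i, fun i j hij => ?_, hT.first, by simpa using hT.last,
    fun i => ⟨le_rfl, ?_⟩⟩, ?_, fun x ω => ?_⟩
  · exact hT.strictMonoOn (Set.mem_Iic.2 (by omega)) (Set.mem_Iic.2 (by omega)) hij
  · simpa using (hT.lt_succ i i.2).le
  · exact Real.iSup_le (fun i => by simpa using hstep i i.2) hδ
  · rw [RSSum, leftSum, ← Finset.range_eq_Ico, Finset.sum_range]
    rfl

/-! ### The `p`-variation as a superadditive function -/

theorem mem_pVarSums_iff {G : Type*} [NormedAddCommGroup G] {p : ℝ} {f : ℝ → G} {a b v : ℝ} :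
    v ∈ pVarSums p f a b ↔ ∃ n T, IsSubdivision n T a b ∧
      v = ∑ i ∈ Finset.range n, ‖f (T (i + 1)) - f (T i)‖ ^ p := by
  constructor
  · rintro ⟨n, t, ht, h0, hn, rfl⟩
    set T : ℕ → ℝ := fun k => t ⟨min k n, by omega⟩
    have hT0 : ∀ i : Fin n, T i = t i.castSucc := fun i =>
      congrArg t (Fin.ext (Nat.min_eq_left i.2.le))
    have hT1 : ∀ i : Fin n, T (i + 1) = t i.succ := fun i =>
      congrArg t (Fin.ext (Nat.min_eq_left i.2))
    refine ⟨n, T, ⟨fun i hi => ?_, ?_, ?_⟩, ?_⟩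
    · rw [hT0 ⟨i, hi⟩, hT1 ⟨i, hi⟩]
      exact ht Fin.castSucc_lt_succ
    · exact (congrArg t (Fin.ext (by simp))).trans h0
    · exact (congrArg t (Fin.ext (by simp))).trans hn
    · rw [Finset.sum_range]
      exact Finset.sum_congr rfl fun i _ => by rw [hT0, hT1]
  · rintro ⟨n, T, hT, rfl⟩
    refine ⟨n, fun i => T i, fun i j hij => ?_, hT.first, by simpa using hT.last, ?_⟩
    · exact hT.strictMonoOn (Set.mem_Iic.2 (by omega)) (Set.mem_Iic.2 (by omega)) hij
    · rw [Finset.sum_range]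
      rfl

section PVariation

variable {G : Type*} [NormedAddCommGroup G] {p : ℝ} {f : ℝ → G} {a b : ℝ}

theorem pVarSums_nonneg {v : ℝ} (hv : v ∈ pVarSums p f a b) : 0 ≤ v := by
  obtain ⟨n, T, -, rfl⟩ := mem_pVarSums_iff.1 hv
  positivity

theorem add_mem_pVarSums {c v w : ℝ} (hv : v ∈ pVarSums p f a b) (hw : w ∈ pVarSums p f b c) :
    v + w ∈ pVarSums p f a c := by
  obtain ⟨n, T, hT, rfl⟩ := mem_pVarSums_iff.1 hv
  obtain ⟨n', T', hT', rfl⟩ := mem_pVarSums_iff.1 hw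
  refine mem_pVarSums_iff.2 ⟨_, _, hT.concat hT', ?_⟩
  rw [Finset.sum_range_add]
  congr 1
  · refine Finset.sum_congr rfl fun i hi => ?_
    have := Finset.mem_range.1 hi
    simp [this.le, Nat.succ_le_of_lt this]
  · refine Finset.sum_congr rfl fun i hi => ?_
    rcases Nat.eq_zero_or_pos i with rfl | hi
    · simp [hT.last, hT'.first]
    · simp [hi.ne', add_assoc]

theorem norm_rpow_mem_pVarSums (hp : p ≠ 0) (hab : a ≤ b) :
    ‖f b - f a‖ ^ p ∈ pVarSums p f a b := by
  rcases hab.eq_or_lt with rfl | hab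
  · exact mem_pVarSums_iff.2 ⟨0, _, IsSubdivision.refl a, by simp [Real.zero_rpow hp]⟩
  · exact mem_pVarSums_iff.2 ⟨1, fun i => if i = 0 then a else b,
      ⟨by simpa using hab, by simp, by simp⟩, by simp⟩

theorem FinitePVar.restrict (hf : FinitePVar p f a b) (hp : p ≠ 0) {s t : ℝ} (hs : a ≤ s)
    (ht : t ≤ b) : FinitePVar p f s t := by
  obtain ⟨M, hM⟩ := hf
  refine ⟨M, fun v hv => ?_⟩
  have h1 := norm_rpow_mem_pVarSums (f := f) hp hs
  have h2 := norm_rpow_mem_pVarSums (f := f) hp ht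
  have h3 := hM (add_mem_pVarSums (add_mem_pVarSums h1 hv) h2)
  linarith [pVarSums_nonneg h1, pVarSums_nonneg h2]

theorem FinitePVar.superadditiveOn (hf : FinitePVar p f a b) (hp : p ≠ 0) :
    SuperadditiveOn (fun s t => sSup (pVarSums p f s t)) a b where
  nonneg s t _ _ _ := Real.sSup_nonneg fun _ hv => pVarSums_nonneg hv
  add_le s u t hs hsu hut ht := by
    rw [← le_sub_iff_add_le]
    refine csSup_le ⟨_, norm_rpow_mem_pVarSums hp hsu⟩ fun v hv => ?_
    rw [le_sub_comm]
    refine csSup_le ⟨_, norm_rpow_mem_pVarSums hp hut⟩ fun w hw => ?_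
    rw [le_sub_iff_add_le, add_comm]
    exact le_csSup (hf.restrict hp hs ht) (add_mem_pVarSums hv hw)

theorem FinitePVar.norm_sub_rpow_le (hf : FinitePVar p f a b) (hp : p ≠ 0) {s t u v : ℝ}
    (hs : a ≤ s) (ht : t ≤ b) (hu : u ∈ Set.Icc s t) (hv : v ∈ Set.Icc s t) :
    ‖f v - f u‖ ^ p ≤ sSup (pVarSums p f s t) := by
  wlog huv : u ≤ v generalizing u v
  · rw [norm_sub_rev]
    exact this hv hu (le_of_not_ge huv)
  refine (le_csSup (hf.restrict hp (hs.trans hu.1) (hv.2.trans ht))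
    (norm_rpow_mem_pVarSums hp huv)).trans ?_
  exact (hf.superadditiveOn hp).mono hs hu.1 huv hv.2 ht

theorem FinitePVar.norm_sub_le (hf : FinitePVar p f a b) (hp : 0 < p) {s t u v : ℝ}
    (hs : a ≤ s) (ht : t ≤ b) (hu : u ∈ Set.Icc s t) (hv : v ∈ Set.Icc s t) :
    ‖f v - f u‖ ≤ pVar p f s t := by
  have h := Real.rpow_le_rpow (by positivity) (hf.norm_sub_rpow_le hp.ne' hs ht hu hv)
    (one_div_nonneg.2 hp.le)
  rwa [one_div, Real.rpow_rpow_inv (norm_nonneg _) hp.ne', ← one_div] at h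

theorem FinitePVar.pVar_mono (hf : FinitePVar p f a b) (hp : 0 < p) {s t : ℝ}
    (hs : a ≤ s) (hst : s ≤ t) (ht : t ≤ b) : pVar p f s t ≤ pVar p f a b :=
  Real.rpow_le_rpow ((hf.superadditiveOn hp.ne').nonneg s t hs hst ht)
    ((hf.superadditiveOn hp.ne').mono le_rfl hs hst ht le_rfl) (one_div_nonneg.2 hp.le)

theorem pVar_nonneg : 0 ≤ pVar p f a b :=
  Real.rpow_nonneg (Real.sSup_nonneg fun _ hv => pVarSums_nonneg hv) _

theorem pVar_rpow (hp : p ≠ 0) : pVar p f a b ^ p = sSup (pVarSums p f a b) := by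
  rw [pVar, one_div, Real.rpow_inv_rpow (Real.sSup_nonneg fun _ hv => pVarSums_nonneg hv) hp]

/-- A path whose increments are dominated by the `p`-variation of another one. -/
theorem finitePVar_and_pVar_le {H : Type*} [NormedAddCommGroup H] {g : ℝ → H} {C : ℝ}
    (hf : FinitePVar p f a b) (hp : 0 < p) (hab : a ≤ b) (hC : 0 ≤ C)
    (hg : ∀ s t, a ≤ s → s ≤ t → t ≤ b → ‖g t - g s‖ ≤ pVar p f s t * C) :
    FinitePVar p g a b ∧ pVar p g a b ≤ pVar p f a b * C := by
  have hV := hf.superadditiveOn hp.ne'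
  have bound : ∀ v ∈ pVarSums p g a b, v ≤ (pVar p f a b * C) ^ p := by
    intro v hv
    obtain ⟨n, T, hT, rfl⟩ := mem_pVarSums_iff.1 hv
    rw [Real.mul_rpow pVar_nonneg hC, pVar_rpow hp.ne']
    refine le_trans ?_ (mul_le_mul_of_nonneg_right (hV.sum_le hT) (Real.rpow_nonneg hC p))
    rw [Finset.sum_mul]
    refine Finset.sum_le_sum fun i hi => ?_
    have hi := Finset.mem_range.1 hi
    have := Real.rpow_le_rpow (norm_nonneg _) (hg _ _ (hT.left_le hi.le) (hT.lt_succ i hi).le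
      (hT.le_right hi)) hp.le
    rwa [Real.mul_rpow pVar_nonneg hC, pVar_rpow hp.ne'] at this
  refine ⟨⟨_, bound⟩, ?_⟩
  have hnn : 0 ≤ pVar p f a b * C := mul_nonneg pVar_nonneg hC
  have := Real.rpow_le_rpow (Real.sSup_nonneg fun _ hv => pVarSums_nonneg hv)
    (csSup_le ⟨_, norm_rpow_mem_pVarSums hp.ne' hab⟩ bound) (one_div_nonneg.2 hp.le)
  rwa [one_div, Real.rpow_rpow_inv hnn hp.ne', ← one_div] at this

end PVariation

/-! ### Existence of the Young integral -/

theorem SuperadditiveOn.rpow {a b : ℝ} (hW : SuperadditiveOn W a b) (hθ : 1 ≤ θ) :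
    SuperadditiveOn (fun s t => W s t ^ θ) a b where
  nonneg s t hs hst ht := Real.rpow_nonneg (hW.nonneg s t hs hst ht) _
  add_le s u t hs hsu hut ht := by
    have h1 := hW.nonneg s u hs hsu (hut.trans ht)
    have h2 := hW.nonneg u t (hs.trans hsu) hut ht
    exact (Real.add_rpow_le_rpow_add h1 h2 hθ).trans
      (Real.rpow_le_rpow (by positivity) (hW.add_le s u t hs hsu hut ht) (by linarith))

theorem sum_leftSum {R : ℕ → ℝ} {φ : ℕ → ℕ} (hφ : ∀ i < n, φ i ≤ φ (i + 1)) :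
    ∑ i ∈ Finset.range n, leftSum x ω R (φ i) (φ (i + 1)) = leftSum x ω R (φ 0) (φ n) ∧
      φ 0 ≤ φ n := by
  induction n with
  | zero => simp [leftSum]
  | succ n ih =>
    obtain ⟨h1, h2⟩ := ih fun i hi => hφ i (by omega)
    have h3 := hφ n n.lt_succ_self
    exact ⟨by rw [Finset.sum_range_succ, h1, leftSum_add h2 h3], h2.trans h3⟩

/-- Comparison of a tagged sum with the left-point sum along a refinement. -/
theorem norm_taggedSum_sub_leftSum_le {a b : ℝ} {δ : ℝ} (hW : SuperadditiveOn W a b) (hθ : 1 < θ)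
    (hc : 0 ≤ c)
    (hxω : ∀ s t, a ≤ s → s ≤ t → t ≤ b → t - s < δ → ∀ u ∈ Set.Icc s t, ∀ v ∈ Set.Icc s t,
      ∀ y ∈ Set.Icc s t, ∀ z ∈ Set.Icc s t, ‖x v - x u‖ * ‖ω z - ω y‖ ≤ c * W s t ^ θ)
    (hT : IsSubdivision n T a b) {ξ : ℕ → ℝ} (hξ : ∀ i < n, ξ i ∈ Set.Icc (T i) (T (i + 1)))
    (hδ : ∀ i < n, T (i + 1) - T i < δ) {R : ℕ → ℝ} {N : ℕ} (hR : StrictMonoOn R (Set.Iic N))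
    {φ : ℕ → ℕ} (hφN : ∀ i ≤ n, φ i ≤ N) (hφ : ∀ i ≤ n, R (φ i) = T i) :
    ‖∑ i ∈ Finset.range n, x (ξ i) (ω (T (i + 1)) - ω (T i)) - leftSum x ω R (φ 0) (φ n)‖ ≤
      c * (1 + 2 * youngConst θ) * W a b ^ θ := by
  have hφmono : ∀ i < n, φ i ≤ φ (i + 1) := fun i hi =>
    (hR.le_iff_le (hφN i hi.le) (hφN (i + 1) hi)).1
      (by rw [hφ i hi.le, hφ (i + 1) hi]; exact (hT.lt_succ i hi).le)
  have hK := (youngConst_pos hθ).le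
  rw [← (sum_leftSum hφmono).1, ← Finset.sum_sub_distrib]
  refine (norm_sum_le _ _).trans (le_trans ?_
    (mul_le_mul_of_nonneg_left ((hW.rpow hθ.le).sum_le hT)
      (by positivity : 0 ≤ c * (1 + 2 * youngConst θ))))
  rw [Finset.mul_sum]
  refine Finset.sum_le_sum fun i hi => ?_
  have hi : i < n := Finset.mem_range.1 hi
  have hle := (hT.lt_succ i hi).le
  have ha := hT.left_le hi.le
  have hb := hT.le_right hi
  have h1 : ‖(x (ξ i) - x (T i)) (ω (T (i + 1)) - ω (T i))‖ ≤ c * W (T i) (T (i + 1)) ^ θ :=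
    (ContinuousLinearMap.le_opNorm _ _).trans
      (hxω _ _ ha hle hb (hδ i hi) _ (Set.left_mem_Icc.2 hle) _ (hξ i hi) _
        (Set.left_mem_Icc.2 hle) _ (Set.right_mem_Icc.2 hle))
  have h2 : ‖leftDefect x ω R (φ i) (φ (i + 1))‖ ≤
      2 * c * youngConst θ * W (T i) (T (i + 1)) ^ θ := by
    rw [← hφ i hi.le, ← hφ (i + 1) hi]
    refine norm_leftDefect_le (hW.restrict ha hb) hθ hc (fun u v w hu huv hvw hw => ?_)
      hR.monotoneOn (hφmono i hi) (hφN _ hi) (hφ i hi.le).ge (hφ (i + 1) hi).le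
    exact hxω u w (ha.trans hu) (huv.trans hvw) (hw.trans hb) (by linarith [hδ i hi])
      u ⟨le_rfl, huv.trans hvw⟩ v ⟨huv, hvw⟩ v ⟨huv, hvw⟩ w ⟨huv.trans hvw, le_rfl⟩
  have h3 : x (ξ i) (ω (T (i + 1)) - ω (T i)) - leftSum x ω R (φ i) (φ (i + 1)) =
      (x (ξ i) - x (T i)) (ω (T (i + 1)) - ω (T i)) - leftDefect x ω R (φ i) (φ (i + 1)) := by
    rw [leftDefect, hφ i hi.le, hφ (i + 1) hi, sub_apply]
    abel
  rw [h3]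
  refine (norm_sub_le _ _).trans ?_
  linarith

theorem norm_RSSum_sub_RSSum_le {a b : ℝ} {δ : ℝ} (hW : SuperadditiveOn W a b) (hθ : 1 < θ)
    (hc : 0 ≤ c)
    (hxω : ∀ s t, a ≤ s → s ≤ t → t ≤ b → t - s < δ → ∀ u ∈ Set.Icc s t, ∀ v ∈ Set.Icc s t,
      ∀ y ∈ Set.Icc s t, ∀ z ∈ Set.Icc s t, ‖x v - x u‖ * ‖ω z - ω y‖ ≤ c * W s t ^ θ)
    (P Q : TaggedPartition a b) (hP : P.mesh < δ) (hQ : Q.mesh < δ) :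
    ‖RSSum x ω P - RSSum x ω Q‖ ≤ 2 * (c * (1 + 2 * youngConst θ) * W a b ^ θ) := by
  obtain ⟨T, ξ, hT, hξ, hTP, hPsum⟩ := P.exists_isSubdivision (E := E) (F := F)
  obtain ⟨T', ξ', hT', hξ', hTQ, hQsum⟩ := Q.exists_isSubdivision (E := E) (F := F)
  obtain ⟨N, R, hR, hRU⟩ := IsSubdivision.exists_of_finset
    ((Finset.range (P.n + 1)).image T ∪ (Finset.range (Q.n + 1)).image T') (by simp)
  have hφ : ∀ i, ∃ k, i ≤ P.n → k ≤ N ∧ R k = T i := fun i => by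
    by_cases hi : i ≤ P.n
    · obtain ⟨k, hk⟩ := hRU (T i) (Finset.mem_union_left _
        (Finset.mem_image_of_mem T (Finset.mem_range.2 (by omega))))
      exact ⟨k, fun _ => hk⟩
    · exact ⟨0, fun h => absurd h hi⟩
  have hψ : ∀ i, ∃ k, i ≤ Q.n → k ≤ N ∧ R k = T' i := fun i => by
    by_cases hi : i ≤ Q.n
    · obtain ⟨k, hk⟩ := hRU (T' i) (Finset.mem_union_right _
        (Finset.mem_image_of_mem T' (Finset.mem_range.2 (by omega))))
      exact ⟨k, fun _ => hk⟩
    · exact ⟨0, fun h => absurd h hi⟩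
  choose φ hφ using hφ
  choose ψ hψ using hψ
  have e0 : φ 0 = ψ 0 := hR.strictMonoOn.injOn (hφ 0 (by omega)).1 (hψ 0 (by omega)).1
    (by rw [(hφ 0 (by omega)).2, (hψ 0 (by omega)).2, hT.first, hT'.first])
  have e1 : φ P.n = ψ Q.n := hR.strictMonoOn.injOn (hφ _ le_rfl).1 (hψ _ le_rfl).1
    (by rw [(hφ _ le_rfl).2, (hψ _ le_rfl).2, hT.last, hT'.last])
  have h1 := norm_taggedSum_sub_leftSum_le hW hθ hc hxω hT hξ
    (fun i hi => (hTP i hi).trans_lt hP) hR.strictMonoOn (fun i hi => (hφ i hi).1)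
    (fun i hi => (hφ i hi).2)
  have h2 := norm_taggedSum_sub_leftSum_le hW hθ hc hxω hT' hξ'
    (fun i hi => (hTQ i hi).trans_lt hQ) hR.strictMonoOn (fun i hi => (hψ i hi).1)
    (fun i hi => (hψ i hi).2)
  rw [← hPsum] at h1
  rw [← hQsum, ← e0, ← e1] at h2
  have h3 := norm_sub_le_norm_sub_add_norm_sub (RSSum x ω P) (leftSum x ω R (φ 0) (φ P.n))
    (RSSum x ω Q)
  rw [norm_sub_rev (leftSum x ω R (φ 0) (φ P.n))] at h3
  linarith

theorem TaggedPartition.exists_mesh_lt {a b δ : ℝ} (hab : a ≤ b) (hδ : 0 < δ) :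
    ∃ P : TaggedPartition a b, P.mesh < δ := by
  obtain ⟨n, T, hT, hstep⟩ := IsSubdivision.exists_fine hab (half_pos hδ)
  obtain ⟨P, hP, -⟩ := hT.exists_taggedPartition (E := ℝ) (F := ℝ) (half_pos hδ).le hstep
  exact ⟨P, hP.trans_lt (half_lt_self hδ)⟩

theorem exists_isYoungIntegral_of_cauchy [CompleteSpace F] {a b : ℝ} (hab : a ≤ b)
    (h : ∀ ε > 0, ∃ δ > 0, ∀ P Q : TaggedPartition a b, P.mesh < δ → Q.mesh < δ →
      ‖RSSum x ω P - RSSum x ω Q‖ < ε) :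
    ∃ v, IsYoungIntegral x ω a b v := by
  choose P hP using fun n : ℕ =>
    TaggedPartition.exists_mesh_lt hab (Nat.one_div_pos_of_nat (α := ℝ) (n := n))
  have hmesh : ∀ δ > 0, ∃ N, ∀ n ≥ N, (P n).mesh < δ := fun δ hδ => by
    obtain ⟨N, hN⟩ := exists_nat_one_div_lt hδ
    exact ⟨N, fun n hn => (hP n).trans ((Nat.one_div_le_one_div hn).trans_lt hN)⟩
  have hcauchy : CauchySeq fun n => RSSum x ω (P n) := by
    refine Metric.cauchySeq_iff.2 fun ε hε => ?_
    obtain ⟨δ, hδ, hPQ⟩ := h ε hε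
    obtain ⟨N, hN⟩ := hmesh δ hδ
    exact ⟨N, fun m hm n hn => by rw [dist_eq_norm]; exact hPQ _ _ (hN m hm) (hN n hn)⟩
  obtain ⟨v, hv⟩ := cauchySeq_tendsto_of_complete hcauchy
  refine ⟨v, fun ε hε => ?_⟩
  obtain ⟨δ, hδ, hPQ⟩ := h (ε / 2) (half_pos hε)
  refine ⟨δ, hδ, fun Q hQ => ?_⟩
  obtain ⟨N, hN⟩ := hmesh δ hδ
  obtain ⟨N', hN'⟩ := Metric.tendsto_atTop.1 hv (ε / 2) (half_pos hε)
  have h1 := hPQ Q (P (max N N')) hQ (hN _ (le_max_left _ _))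
  have h2 := hN' (max N N') (le_max_right _ _)
  rw [dist_eq_norm] at h2
  have := norm_sub_le_norm_sub_add_norm_sub (RSSum x ω Q) (RSSum x ω (P (max N N'))) v
  linarith

theorem isYoungIntegral_youngIntegral_of_exists {a b : ℝ} (h : ∃ v, IsYoungIntegral x ω a b v) :
    IsYoungIntegral x ω a b (youngIntegral x ω a b) := by
  rw [youngIntegral, dif_pos h]
  exact h.choose_spec

/-- An oscillation bound trades part of the exponent of the `q`-variation for smallness. -/
theorem FinitePVar.norm_mul_norm_le {G H : Type*} [NormedAddCommGroup G] [NormedAddCommGroup H]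
    {f : ℝ → G} {g : ℝ → H} {p q a b α ε : ℝ} (hf : FinitePVar q f a b) (hg : FinitePVar p g a b)
    (hp : 0 < p) (hq : 0 < q) (hα : 0 < α) (hαq : α * q < 1) {s t u v y z : ℝ} (hs : a ≤ s)
    (ht : t ≤ b) (hu : u ∈ Set.Icc s t) (hv : v ∈ Set.Icc s t) (hy : y ∈ Set.Icc s t)
    (hz : z ∈ Set.Icc s t) (hε : ‖f v - f u‖ ≤ ε) :
    ‖f v - f u‖ * ‖g z - g y‖ ≤ ε ^ (1 - α * q) *
      (sSup (pVarSums q f s t) ^ α * sSup (pVarSums p g s t) ^ (1 / p)) := by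
  have h1 : ‖f v - f u‖ ≤ ε ^ (1 - α * q) * sSup (pVarSums q f s t) ^ α := by
    have e : ‖f v - f u‖ = ‖f v - f u‖ ^ (1 - α * q) * (‖f v - f u‖ ^ q) ^ α := by
      rw [← Real.rpow_mul (norm_nonneg _), ← Real.rpow_add' (norm_nonneg _)]
      · rw [show 1 - α * q + q * α = 1 by ring, Real.rpow_one]
      · rw [show 1 - α * q + q * α = 1 by ring]; exact one_ne_zero
    rw [e]
    have h2 := hf.norm_sub_rpow_le hq.ne' hs ht hu hv
    have h3 : 0 ≤ ε := (norm_nonneg _).trans hε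
    exact mul_le_mul (Real.rpow_le_rpow (norm_nonneg _) hε (by linarith))
      (Real.rpow_le_rpow (by positivity) h2 hα.le) (by positivity) (by positivity)
  rw [← mul_assoc]
  exact mul_le_mul h1 (hg.norm_sub_le hp hs ht hy hz) (norm_nonneg _)
    ((norm_nonneg _).trans h1)

theorem exists_modulus {G : Type*} [NormedAddCommGroup G] {f : ℝ → G} {a b ε : ℝ}
    (hf : ContinuousOn f (Set.Icc a b)) (hε : 0 < ε) :
    ∃ δ > 0, ∀ u ∈ Set.Icc a b, ∀ v ∈ Set.Icc a b, |v - u| < δ → ‖f v - f u‖ ≤ ε := by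
  obtain ⟨δ, hδ, h⟩ := Metric.uniformContinuousOn_iff.1
    (isCompact_Icc.uniformContinuousOn_of_continuous hf) ε hε
  refine ⟨δ, hδ, fun u hu v hv huv => ?_⟩
  rw [← dist_eq_norm]
  exact (h v hv u hu huv).le

theorem rpow_div_mul_rpow_div_rpow {A B α β θ : ℝ} (hA : 0 ≤ A) (hB : 0 ≤ B) (hθ : θ ≠ 0) :
    (A ^ (α / θ) * B ^ (β / θ)) ^ θ = A ^ α * B ^ β := by
  rw [Real.mul_rpow (by positivity) (by positivity), ← Real.rpow_mul hA, ← Real.rpow_mul hB,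
    div_mul_cancel₀ _ hθ, div_mul_cancel₀ _ hθ]

variable {p q a b : ℝ}

theorem isYoungIntegral_youngIntegral [CompleteSpace F] (hp : 1 ≤ p) (hq : 1 ≤ q)
    (hpq : 1 < 1 / p + 1 / q) (hab : a ≤ b) (hx : ContinuousOn x (Set.Icc a b))
    (hxq : FinitePVar q x a b) (hωp : FinitePVar p ω a b) :
    IsYoungIntegral x ω a b (youngIntegral x ω a b) := by
  refine isYoungIntegral_youngIntegral_of_exists
    (exists_isYoungIntegral_of_cauchy hab fun ε hε => ?_)
  have hp0 : 0 < p := by linarith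
  have hq0 : 0 < q := by linarith
  have hβ : 0 < 1 / p := by positivity
  have hβ1 : 1 / p ≤ 1 := by rw [div_le_one hp0]; exact hp
  obtain ⟨α, hα1, hαq⟩ := exists_between (show 1 - 1 / p < 1 / q by linarith)
  have hα : 0 < α := by linarith
  have hαq : α * q < 1 := (lt_div_iff₀ hq0).1 hαq
  set θ := α + 1 / p
  have hθ : 1 < θ := by simp only [θ]; linarith
  have hθ0 : 0 < θ := by linarith
  have hV := hxq.superadditiveOn hq0.ne'
  have hV' := hωp.superadditiveOn hp0.ne'
  have hW := hV.rpow_mul_rpow hV' (div_pos hα hθ0) (div_pos hβ hθ0)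
    (by rw [← add_div]; exact (div_self hθ0.ne').ge)
  have hWθ := fun s t hs hst ht => rpow_div_mul_rpow_div_rpow (α := α) (β := 1 / p)
    (hV.nonneg s t hs hst ht) (hV'.nonneg s t hs hst ht) hθ0.ne'
  set M := (1 + 2 * youngConst θ) *
    (sSup (pVarSums q x a b) ^ (α / θ) * sSup (pVarSums p ω a b) ^ (1 / p / θ)) ^ θ
  have hM : 0 ≤ M := by
    have := (youngConst_pos hθ).le
    have := hW.nonneg a b le_rfl hab le_rfl
    positivity
  have hγ : 0 < 1 - α * q := by linarith
  obtain ⟨κ, hκ, hκε⟩ : ∃ κ : ℝ, 0 < κ ∧ 2 * (κ * M) < ε := by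
    refine ⟨ε / (2 * (M + 1)), by positivity, ?_⟩
    rw [show 2 * (ε / (2 * (M + 1)) * M) = ε * (M / (M + 1)) by field_simp]
    exact mul_lt_of_lt_one_right hε ((div_lt_one (by positivity)).2 (by linarith))
  obtain ⟨δ, hδ, hmod⟩ := exists_modulus hx (Real.rpow_pos_of_pos hκ (1 - α * q)⁻¹)
  refine ⟨δ, hδ, fun P Q hP hQ => ?_⟩
  refine (norm_RSSum_sub_RSSum_le hW hθ hκ.le (fun s t hs hst ht hst' u hu v hv y hy z hz => ?_)
    P Q hP hQ).trans_lt (by rw [mul_assoc κ]; exact hκε)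
  have hε' : ‖x v - x u‖ ≤ κ ^ (1 - α * q)⁻¹ :=
    hmod u ⟨hs.trans hu.1, hu.2.trans ht⟩ v ⟨hs.trans hv.1, hv.2.trans ht⟩
      ((abs_sub_le_of_le_of_le hv.1 hv.2 hu.1 hu.2).trans_lt hst')
  have := hxq.norm_mul_norm_le hωp hp0 hq0 hα hαq hs ht hu hv hy hz hε'
  rwa [Real.rpow_inv_rpow hκ.le hγ.ne', ← hWθ s t hs hst ht] at this

/-! ### The Young–Loève estimate for the integral -/

/-- Additivity of the left-point sums along a concatenation. -/
theorem leftSum_concat {n' : ℕ} {T' : ℕ → ℝ} {s t : ℝ} (h : IsSubdivision n T a s)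
    (h' : IsSubdivision n' T' s t) :
    leftSum x ω (fun i => if i ≤ n then T i else T' (i - n)) 0 (n + n') =
      leftSum x ω T 0 n + leftSum x ω T' 0 n' := by
  simp only [leftSum, ← Finset.range_eq_Ico]
  rw [Finset.sum_range_add]
  congr 1
  · refine Finset.sum_congr rfl fun i hi => ?_
    have := Finset.mem_range.1 hi
    simp [this.le, Nat.succ_le_of_lt this]
  · refine Finset.sum_congr rfl fun i hi => ?_
    rcases Nat.eq_zero_or_pos i with rfl | hi
    · simp [h.last, h'.first]
    · simp [hi.ne', add_assoc]

theorem concat_step_le {n' : ℕ} {T' : ℕ → ℝ} {s t δ : ℝ} (h : IsSubdivision n T a s)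
    (h' : IsSubdivision n' T' s t) (hT : ∀ i < n, T (i + 1) - T i ≤ δ)
    (hT' : ∀ i < n', T' (i + 1) - T' i ≤ δ) (i : ℕ) (hi : i < n + n') :
    (fun i => if i ≤ n then T i else T' (i - n)) (i + 1) -
      (fun i => if i ≤ n then T i else T' (i - n)) i ≤ δ := by
  rcases lt_trichotomy i n with hin | rfl | hin
  · simpa [hin.le, Nat.succ_le_of_lt hin] using hT i hin
  · simpa [h.last, h'.first] using hT' 0 (by omega)
  · have := hT' (i - n) (by omega)
    rw [← Nat.sub_add_comm hin.le] at this
    simpa [not_le.2 hin, show ¬ i + 1 ≤ n by omega] using this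

/-- Increments of the indefinite integral are limits of left-point sums over the increment. -/
theorem exists_norm_sub_leftSum_lt {s t ε δ : ℝ} {I J : F} (has : a ≤ s) (hst : s ≤ t)
    (hI : IsYoungIntegral x ω a s I) (hJ : IsYoungIntegral x ω a t J) (hε : 0 < ε) (hδ : 0 < δ) :
    ∃ n T, IsSubdivision n T s t ∧ (∀ i < n, T (i + 1) - T i ≤ δ) ∧
      ‖(J - I) - leftSum x ω T 0 n‖ < ε := by
  obtain ⟨δ₁, hδ₁, h₁⟩ := hI (ε / 2) (half_pos hε)
  obtain ⟨δ₂, hδ₂, h₂⟩ := hJ (ε / 2) (half_pos hε)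
  obtain ⟨δ', hδ', hlt⟩ := exists_between (lt_min hδ (lt_min hδ₁ hδ₂))
  obtain ⟨hltδ, hlt⟩ := lt_min_iff.1 hlt
  obtain ⟨hlt₁, hlt₂⟩ := lt_min_iff.1 hlt
  obtain ⟨n, T, hT, hTδ⟩ := IsSubdivision.exists_fine has hδ'
  obtain ⟨n', T', hT', hTδ'⟩ := IsSubdivision.exists_fine hst hδ'
  obtain ⟨P, hP, hPs⟩ := hT.exists_taggedPartition (E := E) (F := F) hδ'.le hTδ
  obtain ⟨Q, hQ, hQs⟩ := (hT.concat hT').exists_taggedPartition (E := E) (F := F) hδ'.le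
    (concat_step_le hT hT' hTδ hTδ')
  refine ⟨n', T', hT', fun i hi => (hTδ' i hi).trans hltδ.le, ?_⟩
  have e₁ := h₁ P (hP.trans_lt hlt₁)
  have e₂ := h₂ Q (hQ.trans_lt hlt₂)
  rw [hPs] at e₁
  rw [hQs, leftSum_concat hT hT'] at e₂
  have e₃ : J - I - leftSum x ω T' 0 n' = (leftSum x ω T 0 n - I) -
      (leftSum x ω T 0 n + leftSum x ω T' 0 n' - J) := by abel
  rw [e₃]
  exact (norm_sub_le _ _).trans_lt (by linarith)

theorem norm_youngIntegral_sub_le [CompleteSpace F] (hp : 1 ≤ p) (hq : 1 ≤ q)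
    (hpq : 1 < 1 / p + 1 / q) (hx : ContinuousOn x (Set.Icc a b))
    (hxq : FinitePVar q x a b) (hωp : FinitePVar p ω a b) {s t : ℝ} (hs : a ≤ s) (hst : s ≤ t)
    (ht : t ≤ b) :
    ‖youngIntegral x ω a t - youngIntegral x ω a s - x s (ω t - ω s)‖ ≤
      youngConst (1 / p + 1 / q) * (pVar q x s t * pVar p ω s t) := by
  have hp0 : 0 < p := by linarith
  have hq0 : 0 < q := by linarith
  set θ := 1 / p + 1 / q
  have hθ0 : 0 < θ := by linarith
  have integral : ∀ r, a ≤ r → r ≤ b → IsYoungIntegral x ω a r (youngIntegral x ω a r) :=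
    fun r har hrb => isYoungIntegral_youngIntegral hp hq hpq har
      (hx.mono (Set.Icc_subset_Icc_right hrb)) (hxq.restrict hq0.ne' le_rfl hrb)
      (hωp.restrict hp0.ne' le_rfl hrb)
  have hxq' := hxq.restrict hq0.ne' hs ht
  have hωp' := hωp.restrict hp0.ne' hs ht
  have hV := hxq'.superadditiveOn hq0.ne'
  have hV' := hωp'.superadditiveOn hp0.ne'
  have hW := hV.rpow_mul_rpow hV' (div_pos (one_div_pos.2 hq0) hθ0)
    (div_pos (one_div_pos.2 hp0) hθ0)
    (by rw [← add_div, add_comm (1 / q)]; exact (div_self hθ0.ne').ge)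
  have hWθ := fun u v hu huv hv => rpow_div_mul_rpow_div_rpow (α := 1 / q) (β := 1 / p)
    (hV.nonneg u v hu huv hv) (hV'.nonneg u v hu huv hv) hθ0.ne'
  have hxω : ∀ u v w, s ≤ u → u ≤ v → v ≤ w → w ≤ t → ‖x v - x u‖ * ‖ω w - ω v‖ ≤
      (sSup (pVarSums q x u w) ^ (1 / q / θ) * sSup (pVarSums p ω u w) ^ (1 / p / θ)) ^ θ := by
    intro u v w hu huv hvw hw
    rw [hWθ u w hu (huv.trans hvw) hw]
    exact mul_le_mul
      (hxq'.norm_sub_le hq0 hu hw ⟨le_rfl, huv.trans hvw⟩ ⟨huv, hvw⟩)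
      (hωp'.norm_sub_le hp0 hu hw ⟨huv, hvw⟩ ⟨huv.trans hvw, le_rfl⟩)
      (norm_nonneg _) pVar_nonneg
  have bound : ∀ N : ℕ, ‖youngIntegral x ω a t - youngIntegral x ω a s - x s (ω t - ω s)‖ ≤
      youngConst θ * (1 + ((2 : ℝ) ^ (1 - θ)) ^ N) * (pVar q x s t * pVar p ω s t) := by
    intro N
    refine le_of_forall_pos_le_add fun ε hε => ?_
    have hN : (0 : ℝ) ≤ 2 ^ N - 1 := sub_nonneg.2 (one_le_pow₀ one_le_two)
    have hM : 0 ≤ pVar p ω s t := pVar_nonneg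
    obtain ⟨κ, hκ, hκε⟩ : ∃ κ : ℝ, 0 < κ ∧ (2 ^ N - 1) * (κ * pVar p ω s t) ≤ ε / 2 := by
      refine ⟨ε / 2 / ((2 ^ N - 1) * pVar p ω s t + 1), by positivity, ?_⟩
      rw [show ((2 : ℝ) ^ N - 1) * (ε / 2 / ((2 ^ N - 1) * pVar p ω s t + 1) * pVar p ω s t) =
        ε / 2 * (((2 ^ N - 1) * pVar p ω s t) / ((2 ^ N - 1) * pVar p ω s t + 1)) by ring]
      exact mul_le_of_le_one_right (by positivity)
        ((div_le_one (by positivity)).2 (by linarith))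
    obtain ⟨δ, hδ, hmod⟩ := exists_modulus hx hκ
    obtain ⟨n, T, hT, hTδ, hsum⟩ := exists_norm_sub_leftSum_lt hs hst
      (integral s hs (hst.trans ht)) (integral t (hs.trans hst) ht) (half_pos hε) (half_pos hδ)
    have h1 := norm_leftDefect_le_of_step hW hpq hxω hT.monotoneOn
      (by positivity : 0 ≤ κ * pVar p ω s t) (fun j k hjk hk => ?_) N n.zero_le le_rfl
      hT.first.ge hT.last.le
    · rw [hT.first, hT.last, hWθ s t le_rfl hst le_rfl, leftDefect, hT.first, hT.last] at h1
      have h2 : youngIntegral x ω a t - youngIntegral x ω a s - x s (ω t - ω s) =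
          (youngIntegral x ω a t - youngIntegral x ω a s - leftSum x ω T 0 n) +
          (leftSum x ω T 0 n - x s (ω t - ω s)) := by abel
      rw [h2]
      refine (norm_add_le _ _).trans ?_
      simp only [pVar] at h1 hκε ⊢
      linarith
    · have hjn : j ≤ n := by omega
      have hstep := hT.lt_succ j (by omega)
      refine mul_le_mul (hmod _ ⟨hs.trans (hT.left_le hjn), (hT.le_right hjn).trans ht⟩ _
        ⟨hs.trans (hT.left_le (by omega)), (hT.le_right (by omega)).trans ht⟩ ?_)
        (hωp'.norm_sub_le hp0 le_rfl le_rfl ⟨hT.left_le (by omega), hT.le_right (by omega)⟩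
          ⟨hT.left_le hk, hT.le_right hk⟩) (norm_nonneg _) hκ.le
      rw [abs_of_pos (sub_pos.2 hstep)]
      linarith [hTδ j (by omega)]
  have hlim := ((((tendsto_pow_atTop_nhds_zero_of_lt_one
    (Real.rpow_nonneg zero_le_two (1 - θ)) (two_rpow_one_sub_lt_one hpq)).const_add 1).const_mul
      (youngConst θ)).mul_const (pVar q x s t * pVar p ω s t))
  simpa using ge_of_tendsto' hlim bound

end YoungIntegral

/-- Lemma `lemma1`: for `p, q ≥ 1` with `1/p + 1/q > 1`, a continuous path
`x : [a,b] → ℝ^{d×m}` of finite `q`-variation and a continuous `ω : [a,b] → ℝ^m` of finite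
`p`-variation, the indefinite Young integral `t ↦ ∫_a^t x dω` has finite `p`-variation and
`|||∫_a^· x dω|||_{p-var,[a,b]} ≤ |||ω|||_{p-var,[a,b]} (‖x a‖ + (K+1) |||x|||_{q-var,[a,b]})`
with `K = (1 - 2^(1-θ))⁻¹`, `θ = 1/p + 1/q`. -/
theorem stmt2 {d m : ℕ} (p q a b : ℝ) (hp : 1 ≤ p) (hq : 1 ≤ q)
    (hθ : 1 < 1 / p + 1 / q) (hab : a ≤ b)
    (x : ℝ → (Ed m →L[ℝ] Ed d)) (hx : ContinuousOn x (Set.Icc a b))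
    (hxq : FinitePVar q x a b)
    (ω : ℝ → Ed m) (hω : ContinuousOn ω (Set.Icc a b)) (hωp : FinitePVar p ω a b) :
    FinitePVar p (fun t => youngIntegral x ω a t) a b ∧
    pVar p (fun t => youngIntegral x ω a t) a b ≤
      pVar p ω a b *
        (‖x a‖ + ((1 - (2:ℝ) ^ (1 - (1 / p + 1 / q)))⁻¹ + 1) * pVar q x a b) := by
  have hp0 : 0 < p := by linarith
  have hq0 : 0 < q := by linarith
  have hK : 0 < youngConst (1 / p + 1 / q) := youngConst_pos hθ
  have hX : 0 ≤ pVar q x a b := pVar_nonneg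
  change _ ∧ _ ≤ pVar p ω a b * (‖x a‖ + (youngConst (1 / p + 1 / q) + 1) * pVar q x a b)
  refine finitePVar_and_pVar_le hωp hp0 hab (by positivity) fun s t hs hst ht => ?_
  have hΩ : 0 ≤ pVar p ω s t := pVar_nonneg
  have h1 := norm_youngIntegral_sub_le hp hq hθ hx hxq hωp hs hst ht
  have h2 : ‖x s (ω t - ω s)‖ ≤ (‖x a‖ + pVar q x a b) * pVar p ω s t := by
    refine ((x s).le_opNorm _).trans (mul_le_mul ?_ ?_ (norm_nonneg _) (by positivity))
    · exact (norm_le_norm_add_norm_sub' (x s) (x a)).trans (add_le_add_right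
        (hxq.norm_sub_le hq0 le_rfl le_rfl ⟨le_rfl, hab⟩ ⟨hs, hst.trans ht⟩) _)
    · exact hωp.norm_sub_le hp0 hs ht ⟨le_rfl, hst⟩ ⟨hst, le_rfl⟩
  have h3 : pVar q x s t * pVar p ω s t ≤ pVar q x a b * pVar p ω s t :=
    mul_le_mul_of_nonneg_right (hxq.pVar_mono hq0 hs hst ht) hΩ
  have h4 := mul_le_mul_of_nonneg_left h3 hK.le
  have h5 := norm_le_norm_add_norm_sub' (youngIntegral x ω a t - youngIntegral x ω a s)
    (x s (ω t - ω s))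
  linarith
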